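/- Let d ≥ 2, let P be a d-polytope in ℝ^d, and let L be a full-rank lattice in ℝ^d. Suppose the lattice arrangement L + P = ⋃_{z∈L}(z + P) is weakly (d−2)-impassable, i.e., every (d−2)-dimensional affine subspace of ℝ^d that is parallel to some facet of P intersects L + P. Then L + P is non-separable: every hyperplane of ℝ^d intersects L + P. In particular, the second weak covering minimum satisfies μ₂^w(P, L) > 0. -/

import Mathlib

open Set Metric Pointwise MeasureTheory

noncomputable section

abbrev Euc (d : ℕ) := EuclideanSpace ℝ (Fin d)

variable {d : ℕ}

/-- A convex body: compact, convex, with nonempty interior. -/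
def IsConvexBody (K : Set (Euc d)) : Prop :=
  IsCompact K ∧ Convex ℝ K ∧ (interior K).Nonempty

/-- A hyperplane of `ℝ^d`. -/
def IsHyperplane (H : Set (Euc d)) : Prop :=
  ∃ u : Euc d, u ≠ 0 ∧ ∃ c : ℝ, H = {x : Euc d | (inner ℝ x u : ℝ) = c}

/-- A straight line in `ℝ^d`. -/
def IsLine (L : Set (Euc d)) : Prop :=
  ∃ p v : Euc d, v ≠ 0 ∧ L = {x : Euc d | ∃ t : ℝ, x = p + t • v}

/-- A `d`-polytope: convex hull of finitely many points, with nonempty interior. -/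
def IsPolytope (P : Set (Euc d)) : Prop :=
  ∃ S : Finset (Euc d), P = convexHull ℝ (S : Set (Euc d)) ∧ (interior P).Nonempty

/-- A `d`-simplex: convex hull of `d+1` affinely independent points. -/
def IsSimplex (d : ℕ) (T : Set (Euc d)) : Prop :=
  ∃ v : Fin (d + 1) → Euc d, AffineIndependent ℝ v ∧ T = convexHull ℝ (Set.range v)

/-- The exposed face of `P` in direction `u`. -/
def exposedFaceAt (P : Set (Euc d)) (u : Euc d) : Set (Euc d) :=
  {x ∈ P | ∀ y ∈ P, (inner ℝ y u : ℝ) ≤ (inner ℝ x u : ℝ)}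

/-- `u` is the outer unit normal vector of a facet of `P`. -/
def IsFacetNormal (P : Set (Euc d)) (u : Euc d) : Prop :=
  ‖u‖ = 1 ∧ Module.finrank ℝ (affineSpan ℝ (exposedFaceAt P u)).direction = d - 1

/-- The hyperplane `H` is parallel to some facet of `P`:
some translate of `H` contains the facet. -/
def HypParallelToFacet (P H : Set (Euc d)) : Prop :=
  ∃ u : Euc d, IsFacetNormal P u ∧ ∃ v : Euc d, exposedFaceAt P u ⊆ (fun x => v + x) '' H

/-- The positive homothet `x + τ • P`. -/
def homo (x : Euc d) (τ : ℝ) (P : Set (Euc d)) : Set (Euc d) := {x} + τ • P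

/-- A weakly non-separable family of positive homothets of the polytope `P`. -/
def WNS (P : Set (Euc d)) {n : ℕ} (x : Fin n → Euc d) (τ : Fin n → ℝ) : Prop :=
  ∀ H : Set (Euc d), IsHyperplane H → HypParallelToFacet P H →
    (H ∩ convexHull ℝ (⋃ i, homo (x i) (τ i) P)).Nonempty →
    ∃ i, (H ∩ homo (x i) (τ i) P).Nonempty

/-- A non-separable family of convex bodies. -/
def NS {n : ℕ} (F : Fin n → Set (Euc d)) : Prop :=
  ∀ H : Set (Euc d), IsHyperplane H →
    (H ∩ convexHull ℝ (⋃ i, F i)).Nonempty → ∃ i, (H ∩ F i).Nonempty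

/-- `A` is a `k`-dimensional affine subspace of `ℝ^d` (as a set). -/
def IsAffSub (k : ℕ) (A : Set (Euc d)) : Prop :=
  ∃ S : AffineSubspace ℝ (Euc d), (S : Set (Euc d)) = A ∧ A.Nonempty ∧
    Module.finrank ℝ S.direction = k

/-- The affine subspace `A` is parallel to some facet of `P`:
some translate of `A` is contained in the affine hull of the facet. -/
def SubParallelToFacet (P A : Set (Euc d)) : Prop :=
  ∃ u : Euc d, IsFacetNormal P u ∧ ∃ v : Euc d,
    (fun x => v + x) '' A ⊆ (affineSpan ℝ (exposedFaceAt P u) : Set (Euc d))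

/-- A weakly `k`-impassable family of positive homothets of the polytope `P`. -/
def WIP (k : ℕ) (P : Set (Euc d)) {n : ℕ} (x : Fin n → Euc d) (τ : Fin n → ℝ) : Prop :=
  ∀ A : Set (Euc d), IsAffSub k A → SubParallelToFacet P A →
    (A ∩ convexHull ℝ (⋃ i, homo (x i) (τ i) P)).Nonempty →
    ∃ i, (A ∩ homo (x i) (τ i) P).Nonempty

/-- A full-rank lattice in `ℝ^d`. -/
def IsFullLattice (L : Set (Euc d)) : Prop :=
  ∃ b : Module.Basis (Fin d) ℝ (Euc d),
    L = Set.range fun z : Fin d → ℤ => ∑ i, (z i : ℝ) • b i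

/-- The integer lattice `ℤ^d` as a subset of `ℝ^d`. -/
def intLattice (d : ℕ) : Set (Euc d) := {x : Euc d | ∀ i, ∃ z : ℤ, x i = (z : ℝ)}

/-- The unit cube `[0,1]^d`. -/
def unitCube (d : ℕ) : Set (Euc d) := {x : Euc d | ∀ i, x i ∈ Set.Icc (0 : ℝ) 1}

/-- The axis-parallel hyperplane `{x : x_j = c}`. -/
def axisHyp (d : ℕ) (j : Fin d) (c : ℝ) : Set (Euc d) := {x : Euc d | x j = c}

/-- A weakly non-separable family of translates of the unit cube. -/
def CubeWNS {d n : ℕ} (p : Fin n → Euc d) : Prop :=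
  ∀ (j : Fin d) (c : ℝ),
    (axisHyp d j c ∩ convexHull ℝ (⋃ k, {p k} + unitCube d)).Nonempty →
    ∃ k, (axisHyp d j c ∩ ({p k} + unitCube d)).Nonempty

theorem inner_le_of_mem_convexHull {S : Set (Euc d)} {u : Euc d} {c : ℝ}
    (h : ∀ x ∈ S, (inner ℝ x u : ℝ) ≤ c) {x : Euc d} (hx : x ∈ convexHull ℝ S) :
    (inner ℝ x u : ℝ) ≤ c := by
  have hconv : Convex ℝ {y : Euc d | (inner ℝ y u : ℝ) ≤ c} :=
    convex_halfSpace_le ⟨fun y z => inner_add_left y z u,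
      fun r y => by simp [real_inner_smul_left]⟩ c
  exact convexHull_min h hconv hx

theorem exposedFaceAt_smul (P : Set (Euc d)) (u : Euc d) {r : ℝ} (hr : 0 < r) :
    exposedFaceAt P (r • u) = exposedFaceAt P u := by
  ext x
  simp [exposedFaceAt, real_inner_smul_right, hr]

theorem exposedFaceAt_nonempty {P : Set (Euc d)} (hc : IsCompact P) (hne : P.Nonempty)
    (u : Euc d) : (exposedFaceAt P u).Nonempty := by
  obtain ⟨x, hx, hmax⟩ := hc.exists_isMaxOn hne
    (f := fun y : Euc d => (inner ℝ y u : ℝ)) (by fun_prop)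
  exact ⟨x, hx, fun y hy => hmax hy⟩

/-- An exposed face is orthogonal to its normal vector. -/
theorem vectorSpan_exposedFaceAt_le (P : Set (Euc d)) (u : Euc d) :
    vectorSpan ℝ (exposedFaceAt P u) ≤ (ℝ ∙ u)ᗮ := by
  rw [vectorSpan, Submodule.span_le]
  rintro _ ⟨x, hx, y, hy, rfl⟩
  rw [SetLike.mem_coe, Submodule.mem_orthogonal_singleton_iff_inner_left]
  simp only [vsub_eq_sub, inner_sub_left]
  linarith [hx.2 y hy.1, hy.2 x hx.1]

theorem finrank_orthogonal_singleton {u : Euc d} (hu : u ≠ 0) :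
    Module.finrank ℝ (ℝ ∙ u)ᗮ + 1 = d := by
  have h := (ℝ ∙ u).finrank_add_finrank_orthogonal
  rw [finrank_span_singleton hu, finrank_euclideanSpace_fin] at h
  omega

/-- A nonzero vector is not orthogonal to all differences of an affinely spanning set. -/
theorem exists_inner_sub_ne_zero {S : Set (Euc d)} (hS : affineSpan ℝ S = ⊤) (x₀ : Euc d)
    {v : Euc d} (hv : v ≠ 0) : ∃ x ∈ S, (inner ℝ (x - x₀) v : ℝ) ≠ 0 := by
  by_contra! h
  have hle : vectorSpan ℝ S ≤ (ℝ ∙ v)ᗮ := by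
    rw [vectorSpan, Submodule.span_le]
    rintro _ ⟨x, hx, y, hy, rfl⟩
    rw [SetLike.mem_coe, Submodule.mem_orthogonal_singleton_iff_inner_left]
    beta_reduce
    rw [vsub_eq_sub, ← sub_sub_sub_cancel_right x y x₀, inner_sub_left, h x hx, h y hy, sub_zero]
  rw [← direction_affineSpan, hS, AffineSubspace.direction_top] at hle
  have hmem := hle (Submodule.mem_top (x := v))
  rw [Submodule.mem_orthogonal_singleton_iff_inner_left, inner_self_eq_zero] at hmem
  exact hv hmem

/-- An exposed face of a polytope that is not a facet lies in an exposed face of larger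
dimension, obtained by tilting the supporting hyperplane around it. -/
theorem exists_exposedFaceAt_finrank_lt {P : Set (Euc d)} {S : Finset (Euc d)}
    (hP : P = convexHull ℝ (S : Set (Euc d)))
    (hS : affineSpan ℝ (S : Set (Euc d)) = ⊤) {u : Euc d} (hu : u ≠ 0)
    (hF : (exposedFaceAt P u).Nonempty)
    (hlt : Module.finrank ℝ (vectorSpan ℝ (exposedFaceAt P u)) + 1 < d) :
    ∃ u' : Euc d, u' ≠ 0 ∧
      Module.finrank ℝ (vectorSpan ℝ (exposedFaceAt P u)) <
        Module.finrank ℝ (vectorSpan ℝ (exposedFaceAt P u')) := by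
  have hSP : (S : Set (Euc d)) ⊆ P := hP ▸ subset_convexHull ℝ _
  set W := vectorSpan ℝ (exposedFaceAt P u)
  obtain ⟨x₀, hx₀⟩ := hF
  obtain ⟨v, hv0, hvW, hvu⟩ : ∃ v : Euc d, v ≠ 0 ∧ v ∈ Wᗮ ∧ (inner ℝ v u : ℝ) = 0 := by
    have h1 := (W ⊔ ℝ ∙ u).finrank_add_finrank_orthogonal
    have h2 := Submodule.finrank_add_le_finrank_add_finrank W (ℝ ∙ u)
    rw [finrank_span_singleton hu] at h2
    rw [finrank_euclideanSpace_fin] at h1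
    have h3 : (W ⊔ ℝ ∙ u)ᗮ ≠ ⊥ := by
      intro h
      rw [h, finrank_bot] at h1
      omega
    obtain ⟨v, hv, hv0⟩ := Submodule.exists_mem_ne_zero_of_ne_bot h3
    exact ⟨v, hv0, Submodule.orthogonal_le le_sup_left hv,
      (Submodule.mem_orthogonal_singleton_iff_inner_left).1
        (Submodule.orthogonal_le le_sup_right hv)⟩
  obtain ⟨v, hvW, hvu, hpos⟩ : ∃ v : Euc d, v ∈ Wᗮ ∧ (inner ℝ v u : ℝ) = 0 ∧
      ∃ x ∈ S, 0 < (inner ℝ (x - x₀) v : ℝ) := by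
    obtain ⟨x, hx, hne⟩ := exists_inner_sub_ne_zero hS x₀ hv0
    rcases hne.lt_or_gt with h | h
    · refine ⟨-v, neg_mem hvW, ?_, x, hx, ?_⟩
      · rw [inner_neg_left, hvu, neg_zero]
      · rw [inner_neg_right]
        linarith
    · exact ⟨v, hvW, hvu, x, hx, h⟩
  have hle : ∀ x ∈ P, (inner ℝ (x - x₀) u : ℝ) ≤ 0 := fun x hx => by
    rw [inner_sub_left]
    linarith [hx₀.2 x hx]
  have hface : ∀ x ∈ exposedFaceAt P u, (inner ℝ (x - x₀) v : ℝ) = 0 := fun x hx =>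
    hvW _ (vsub_mem_vectorSpan ℝ hx hx₀)
  have hfaceu : ∀ x ∈ exposedFaceAt P u, (inner ℝ (x - x₀) u : ℝ) = 0 := fun x hx => by
    rw [inner_sub_left]
    linarith [hx.2 x₀ hx₀.1, hx₀.2 x hx.1]
  let T := S.filter fun x => 0 < (inner ℝ (x - x₀) v : ℝ)
  have hT : T.Nonempty := by
    obtain ⟨x, hx, h⟩ := hpos
    exact ⟨x, Finset.mem_filter.2 ⟨hx, h⟩⟩
  obtain ⟨x₁, hx₁, hmin⟩ := T.exists_min_image
    (fun x => -(inner ℝ (x - x₀) u : ℝ) / (inner ℝ (x - x₀) v : ℝ)) hT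
  obtain ⟨hx₁S, hx₁v⟩ := Finset.mem_filter.1 hx₁
  set s := -(inner ℝ (x₁ - x₀) u : ℝ) / (inner ℝ (x₁ - x₀) v : ℝ) with hs
  have hs0 : 0 ≤ s :=
    div_nonneg (neg_nonneg.2 (hle x₁ (hSP hx₁S))) hx₁v.le
  have hexp : ∀ x : Euc d, (inner ℝ (x - x₀) (u + s • v) : ℝ) =
      inner ℝ (x - x₀) u + s * inner ℝ (x - x₀) v := fun x => by
    rw [inner_add_right, real_inner_smul_right]
  have hle' : ∀ x ∈ P, (inner ℝ x (u + s • v) : ℝ) ≤ inner ℝ x₀ (u + s • v) := by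
    intro x hx
    refine inner_le_of_mem_convexHull (fun y hy => ?_) (hP ▸ hx)
    rw [← sub_nonpos, ← inner_sub_left, hexp]
    have hyu := hle y (hSP hy)
    rcases le_or_gt (inner ℝ (y - x₀) v : ℝ) 0 with h | h
    · nlinarith
    · have := hmin y (Finset.mem_filter.2 ⟨hy, h⟩)
      rw [le_div_iff₀ h] at this
      linarith
  have hmem : ∀ x ∈ P, (inner ℝ (x - x₀) (u + s • v) : ℝ) = 0 →
      x ∈ exposedFaceAt P (u + s • v) := fun x hx h => by
    refine ⟨hx, fun y hy => (hle' y hy).trans ?_⟩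
    rw [inner_sub_left] at h
    linarith
  have hsub : exposedFaceAt P u ⊆ exposedFaceAt P (u + s • v) := fun x hx =>
    hmem x hx.1 (by rw [hexp, hface x hx, hfaceu x hx, mul_zero, add_zero])
  have hx₁mem : x₁ ∈ exposedFaceAt P (u + s • v) := by
    refine hmem x₁ (hSP hx₁S) ?_
    rw [hexp, hs, div_mul_cancel₀ _ hx₁v.ne']
    ring
  refine ⟨u + s • v, fun h => hu ?_, ?_⟩
  · have h2 : (inner ℝ (u + s • v) u : ℝ) = inner ℝ u u := by
      rw [inner_add_left, real_inner_smul_left, hvu, mul_zero, add_zero]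
    rw [h, inner_zero_left] at h2
    exact inner_self_eq_zero.1 h2.symm
  · refine Submodule.finrank_lt_finrank_of_lt (lt_of_le_of_ne (vectorSpan_mono ℝ hsub) ?_)
    intro heq
    have h1 : x₁ - x₀ ∈ W := by
      rw [heq]
      exact vsub_mem_vectorSpan ℝ hx₁mem (hsub hx₀)
    exact hx₁v.ne' (hvW _ h1)

theorem IsPolytope.isCompact {P : Set (Euc d)} (hP : IsPolytope P) : IsCompact P := by
  obtain ⟨S, rfl, -⟩ := hP
  exact S.finite_toSet.isCompact_convexHull ℝ

theorem IsPolytope.nonempty {P : Set (Euc d)} (hP : IsPolytope P) : P.Nonempty := by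
  obtain ⟨S, -, hint⟩ := hP
  exact hint.mono interior_subset

theorem IsPolytope.exists_isFacetNormal {P : Set (Euc d)} (hP : IsPolytope P) (hd : 1 ≤ d) :
    ∃ u : Euc d, IsFacetNormal P u := by
  have hface := exposedFaceAt_nonempty hP.isCompact hP.nonempty
  obtain ⟨S, hPS, hint⟩ := hP
  have hS := affineSpan_eq_top_of_nonempty_interior (hPS ▸ hint)
  let dims : Set ℕ :=
    {k | ∃ u : Euc d, u ≠ 0 ∧ Module.finrank ℝ (vectorSpan ℝ (exposedFaceAt P u)) = k}
  have hbound : ∀ u : Euc d, u ≠ 0 →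
      Module.finrank ℝ (vectorSpan ℝ (exposedFaceAt P u)) + 1 ≤ d := fun u hu => by
    have h1 := Submodule.finrank_mono (vectorSpan_exposedFaceAt_le P u)
    have h2 := finrank_orthogonal_singleton hu
    omega
  have hbdd : BddAbove dims := ⟨d, by
    rintro k ⟨u, hu, rfl⟩
    have := hbound u hu
    omega⟩
  have hne : dims.Nonempty :=
    ⟨_, EuclideanSpace.single ⟨0, hd⟩ 1, by simp, rfl⟩
  obtain ⟨u, hu, hk⟩ := Nat.sSup_mem hne hbdd
  have hdim : Module.finrank ℝ (vectorSpan ℝ (exposedFaceAt P u)) = d - 1 := by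
    have h1 := hbound u hu
    by_contra hcon
    obtain ⟨u', hu', hlt⟩ := exists_exposedFaceAt_finrank_lt hPS hS hu (hface u) (by omega)
    have h2 := le_csSup hbdd ⟨u', hu', rfl⟩
    omega
  refine ⟨‖u‖⁻¹ • u, norm_smul_inv_norm (𝕜 := ℝ) hu, ?_⟩
  rw [exposedFaceAt_smul P u (inv_pos.2 (norm_pos_iff.2 hu)), direction_affineSpan, hdim]

theorem Submodule.exists_le_finrank_eq_of_le {K V : Type*} [Field K] [AddCommGroup V]
    [Module K V] [FiniteDimensional K V] (D : Submodule K V) {k : ℕ}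
    (hk : k ≤ Module.finrank K D) : ∃ E ≤ D, Module.finrank K E = k := by
  let b := Module.finBasis K D
  have hli : LinearIndependent K fun i : Fin k => (b (Fin.castLE hk i) : V) :=
    (b.linearIndependent.comp _ (Fin.castLE_injective hk)).map' D.subtype D.ker_subtype
  refine ⟨Submodule.span K (Set.range fun i : Fin k => (b (Fin.castLE hk i) : V)), ?_, ?_⟩
  · rw [Submodule.span_le]
    rintro _ ⟨i, rfl⟩
    exact (b (Fin.castLE hk i)).2
  · rw [finrank_span_eq_card hli, Fintype.card_fin]

/-- Every hyperplane contains a `(d - 2)`-dimensional affine subspace parallel to a facet. -/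
theorem IsHyperplane.exists_isAffSub_subParallelToFacet {P H : Set (Euc d)}
    (hP : IsPolytope P) (hd : 1 ≤ d) (hH : IsHyperplane H) :
    ∃ A ⊆ H, IsAffSub (d - 2) A ∧ SubParallelToFacet P A := by
  obtain ⟨u, hu, c, rfl⟩ := hH
  obtain ⟨w, hw⟩ := hP.exists_isFacetNormal hd
  obtain ⟨x₀, hx₀⟩ := exposedFaceAt_nonempty hP.isCompact hP.nonempty w
  have hw0 : w ≠ 0 := norm_ne_zero_iff.1 (by rw [hw.1]; exact one_ne_zero)
  have hdir : (affineSpan ℝ (exposedFaceAt P w)).direction = (ℝ ∙ w)ᗮ := by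
    refine Submodule.eq_of_le_of_finrank_eq ?_ ?_
    · rw [direction_affineSpan]
      exact vectorSpan_exposedFaceAt_le P w
    · have := finrank_orthogonal_singleton hw0
      rw [hw.2]
      omega
  have hD : d - 2 ≤ Module.finrank ℝ ((ℝ ∙ u) ⊔ (ℝ ∙ w))ᗮ := by
    have h1 := ((ℝ ∙ u) ⊔ (ℝ ∙ w)).finrank_add_finrank_orthogonal
    have h2 := Submodule.finrank_add_le_finrank_add_finrank (ℝ ∙ u) (ℝ ∙ w)
    rw [finrank_span_singleton hu, finrank_span_singleton hw0] at h2
    rw [finrank_euclideanSpace_fin] at h1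
    omega
  obtain ⟨E, hED, hE⟩ := Submodule.exists_le_finrank_eq_of_le _ hD
  let p : Euc d := (c / inner ℝ u u) • u
  have hp : (inner ℝ p u : ℝ) = c := by
    rw [real_inner_smul_left, div_mul_cancel₀ _ (inner_self_ne_zero.2 hu)]
  refine ⟨AffineSubspace.mk' p E, fun x hx => ?_,
    ⟨AffineSubspace.mk' p E, rfl, ⟨p, AffineSubspace.self_mem_mk' p E⟩, ?_⟩,
    w, hw, x₀ - p, ?_⟩
  · have h := Submodule.orthogonal_le le_sup_left (hED hx)
    rw [Submodule.mem_orthogonal_singleton_iff_inner_left, vsub_eq_sub, inner_sub_left, hp] at h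
    exact sub_eq_zero.1 h
  · rw [AffineSubspace.direction_mk', hE]
  · rintro _ ⟨x, hx, rfl⟩
    have h : x - p ∈ (affineSpan ℝ (exposedFaceAt P w)).direction := by
      rw [hdir]
      exact Submodule.orthogonal_le le_sup_right (hED hx)
    have h2 := AffineSubspace.vadd_mem_of_mem_direction h (subset_affineSpan ℝ _ hx₀)
    rw [vadd_eq_add] at h2
    change x₀ - p + x ∈ affineSpan ℝ (exposedFaceAt P w)
    convert h2 using 1
    abel

/-- For a full lattice there is a nonzero vector whose inner products with all lattice
vectors are integers. -/
theorem IsFullLattice.exists_inner_int {L : Set (Euc d)} (hL : IsFullLattice L) (hd : 1 ≤ d) :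
    ∃ u : Euc d, u ≠ 0 ∧ ∀ z ∈ L, ∃ n : ℤ, (inner ℝ z u : ℝ) = n := by
  obtain ⟨b, rfl⟩ := hL
  let i₀ : Fin d := ⟨0, hd⟩
  let u : Euc d := (InnerProductSpace.toDual ℝ (Euc d)).symm (b.coord i₀).toContinuousLinearMap
  have hinner : ∀ x : Euc d, (inner ℝ x u : ℝ) = b.coord i₀ x := fun x => by
    rw [real_inner_comm, InnerProductSpace.toDual_symm_apply]
    rfl
  refine ⟨u, fun h => ?_, ?_⟩
  · have h1 := hinner (b i₀)
    rw [h, inner_zero_right] at h1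
    simp at h1
  · rintro _ ⟨z, rfl⟩
    refine ⟨z i₀, ?_⟩
    rw [hinner]
    simp [Finsupp.single_apply]

/-- Scaled copies of a bounded set that meet every hyperplane when translated along a full
lattice have scaling factors bounded away from zero. -/
theorem IsFullLattice.exists_pos_le_of_meets_hyperplanes {L P : Set (Euc d)}
    (hL : IsFullLattice L) (hd : 1 ≤ d) (hP : Bornology.IsBounded P) :
    ∃ ε > 0, ∀ t : ℝ, 0 < t →
      (∀ H : Set (Euc d), IsHyperplane H → (H ∩ (L + t • P)).Nonempty) → ε ≤ t := by
  obtain ⟨u, hu, hint⟩ := hL.exists_inner_int hd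
  obtain ⟨R, hR, hPR⟩ := hP.exists_pos_norm_le
  have hM : 0 < R * ‖u‖ := mul_pos hR (norm_pos_iff.2 hu)
  refine ⟨1 / 2 / (R * ‖u‖), by positivity, fun t ht h => ?_⟩
  obtain ⟨_, hx, z, hz, _, ⟨p, hp, rfl⟩, rfl⟩ := h _ ⟨u, hu, 1 / 2, rfl⟩
  obtain ⟨n, hn⟩ := hint z hz
  have hx' : (n : ℝ) + t * inner ℝ p u = 1 / 2 := by
    rw [← hn, ← real_inner_smul_left, ← inner_add_left]
    exact hx
  have hpu : |(inner ℝ p u : ℝ)| ≤ R * ‖u‖ := (abs_real_inner_le_norm p u).trans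
    (mul_le_mul_of_nonneg_right (hPR p hp) (norm_nonneg u))
  obtain ⟨hlo, hhi⟩ := abs_le.1 hpu
  rw [div_le_iff₀ hM]
  rcases le_or_gt n 0 with hn0 | hn0
  · have : (n : ℝ) ≤ 0 := by exact_mod_cast hn0
    nlinarith
  · have : (1 : ℝ) ≤ n := by exact_mod_cast hn0
    nlinarith

/-- a weakly (d-2)-impassable lattice arrangement of a
d-polytope is non-separable, and its second weak covering minimum is
positive. -/
theorem stmt_19 (d : ℕ) (hd : 2 ≤ d)
    (P : Set (Euc d)) (hP : IsPolytope P)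
    (L : Set (Euc d)) (hL : IsFullLattice L)
    (hWIP : ∀ A : Set (Euc d), IsAffSub (d - 2) A → SubParallelToFacet P A →
      (A ∩ (L + P)).Nonempty) :
    (∀ H : Set (Euc d), IsHyperplane H → (H ∩ (L + P)).Nonempty) ∧
    0 < sInf {t : ℝ | 0 < t ∧ ∀ A : Set (Euc d), IsAffSub (d - 2) A →
      SubParallelToFacet P A → (A ∩ (L + t • P)).Nonempty} := by
  have hd1 : 1 ≤ d := by omega
  have hmeets : ∀ Q : Set (Euc d), (∀ A : Set (Euc d), IsAffSub (d - 2) A →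
      SubParallelToFacet P A → (A ∩ Q).Nonempty) →
      ∀ H : Set (Euc d), IsHyperplane H → (H ∩ Q).Nonempty := fun Q hQ H hH => by
    obtain ⟨A, hAH, hA, hAP⟩ := hH.exists_isAffSub_subParallelToFacet hP hd1
    exact (hQ A hA hAP).mono (inter_subset_inter_left Q hAH)
  obtain ⟨ε, hε, hεt⟩ := hL.exists_pos_le_of_meets_hyperplanes hd1 hP.isCompact.isBounded
  refine ⟨hmeets _ hWIP, hε.trans_le (le_csInf ⟨1, one_pos, ?_⟩ ?_)⟩
  · rwa [one_smul]
  · rintro t ⟨ht, hA⟩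
    exact hεt t ht (hmeets _ hA)

end
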